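/- Let n be a natural number and let K = ∂Δ^n be the abstract simplicial complex on Fin (n+1) consisting of all finsets σ ≠ Finset.univ, so that every subgroup G of Equiv.Perm (Fin (n+1)) acts on K and hence on the n-sphere Z(K;(D¹,S⁰)). Let r be the number of G-orbits on Fin (n+1). Then the G-fixed point set Z(K;(D¹,S⁰))^G is homeomorphic to the (r−1)-sphere Metric.sphere (0 : EuclideanSpace ℝ (Fin r)) 1; moreover r = n+1 if and only if G is the trivial subgroup, so the fixed point set is homeomorphic to the n-sphere if and only if G is trivial. -/

import Mathlib

open Classical

/-- `D¹ = [-1,1]` with the subspace topology. -/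
abbrev D1 : Type := Set.Icc (-1 : ℝ) 1

/-- `S⁰ = {-1, 1} ⊆ D¹`. -/
def S0 : Set D1 := {x : D1 | (x : ℝ) = -1 ∨ (x : ℝ) = 1}

/-- The boundary `∂Δ^n` of the `n`-simplex: all finsets of `Fin (n+1)` except `univ`. -/
def simplexBoundary (n : ℕ) : Set (Finset (Fin (n + 1))) :=
  {σ : Finset (Fin (n + 1)) | σ ≠ Finset.univ}

/-- A continuous linear equivalence between real normed spaces induces a homeomorphism of unit
spheres by radial projection. -/
noncomputable def ContinuousLinearEquiv.unitSphereHomeomorph {E F : Type*}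
    [NormedAddCommGroup E] [NormedSpace ℝ E] [NormedAddCommGroup F] [NormedSpace ℝ F]
    (L : E ≃L[ℝ] F) : Metric.sphere (0 : E) 1 ≃ₜ Metric.sphere (0 : F) 1 :=
  have ne_zero (x : Metric.sphere (0 : E) 1) : ‖L x‖ ≠ 0 := by
    simpa using ne_zero_of_mem_unit_sphere x
  have symm_ne_zero (y : Metric.sphere (0 : F) 1) : ‖L.symm y‖ ≠ 0 := by
    simpa using ne_zero_of_mem_unit_sphere y
  { toFun x := ⟨‖L x‖⁻¹ • L x, by simpa [norm_smul] using inv_mul_cancel₀ (ne_zero x)⟩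
    invFun y := ⟨‖L.symm y‖⁻¹ • L.symm y, by
      simpa [norm_smul] using inv_mul_cancel₀ (symm_ne_zero y)⟩
    left_inv x := by
      ext1
      simp [norm_smul, smul_smul, ne_zero x]
    right_inv y := by
      ext1
      simp [norm_smul, smul_smul, symm_ne_zero y]
    continuous_toFun := by
      have h : Continuous fun x : Metric.sphere (0 : E) 1 => L x := by fun_prop
      exact ((h.norm.inv₀ ne_zero).smul h).subtype_mk _
    continuous_invFun := by
      have h : Continuous fun y : Metric.sphere (0 : F) 1 => L.symm y := by fun_prop
      exact ((h.norm.inv₀ symm_ne_zero).smul h).subtype_mk _ }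

theorem mem_S0_iff_abs_eq_one (x : D1) : x ∈ S0 ↔ |(x : ℝ)| = 1 := by
  rw [abs_eq zero_le_one, or_comm]
  rfl

theorem filter_notMem_S0_mem_simplexBoundary_iff {n : ℕ} (f : Fin (n + 1) → D1) :
    Finset.filter (fun i => f i ∉ S0) Finset.univ ∈ simplexBoundary n ↔
      ∃ i, |(f i : ℝ)| = 1 := by
  simp [simplexBoundary, Finset.filter_eq_self, mem_S0_iff_abs_eq_one]

theorem pi_norm_eq_one_iff {ι : Type*} [Fintype ι] (h : ι → ℝ) :
    ‖h‖ = 1 ↔ (∀ i, |h i| ≤ 1) ∧ ∃ i, |h i| = 1 := by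
  constructor
  · intro hh
    have hle (i : ι) : |h i| ≤ 1 := hh ▸ norm_le_pi_norm h i
    refine ⟨hle, ?_⟩
    by_contra! hne
    exact ((pi_norm_lt_iff one_pos).2 fun i => (hle i).lt_of_ne (hne i)).ne hh
  · rintro ⟨hle, i, hi⟩
    exact le_antisymm ((pi_norm_le_iff_of_nonneg zero_le_one).2 hle) (hi ▸ norm_le_pi_norm h i)

/-- The fixed points of `G` on `Z(∂Δ^n;(D¹,S⁰))` form the unit sphere, for the sup norm, of the
space of real functions on the set of orbits. -/
noncomputable def fixedPointsHomeomorphSupSphere (n : ℕ)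
    (G : Subgroup (Equiv.Perm (Fin (n + 1)))) :
    {f : Fin (n + 1) → D1 //
        Finset.filter (fun i => f i ∉ S0) Finset.univ ∈ simplexBoundary n ∧
        ∀ g ∈ G, ∀ i : Fin (n + 1), f (g⁻¹ i) = f i} ≃ₜ
      Metric.sphere (0 : Quotient (MulAction.orbitRel G (Fin (n + 1))) → ℝ) 1 :=
  have out_eq (f : Fin (n + 1) → D1) (hf : ∀ g ∈ G, ∀ i : Fin (n + 1), f (g⁻¹ i) = f i)
      (i : Fin (n + 1)) :
      f (Quotient.mk (MulAction.orbitRel G (Fin (n + 1))) i).out = f i := by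
    obtain ⟨g, hg⟩ := Quotient.mk_out (s := MulAction.orbitRel G (Fin (n + 1))) i
    rw [← hg]
    simpa [Subgroup.smul_def] using hf (g : Equiv.Perm (Fin (n + 1)))⁻¹ (inv_mem g.2) i
  { toFun f := ⟨fun q => f.1 q.out, by
      obtain ⟨f, hb, hf⟩ := f
      obtain ⟨i, hi⟩ := (filter_notMem_S0_mem_simplexBoundary_iff f).1 hb
      rw [mem_sphere_zero_iff_norm, pi_norm_eq_one_iff]
      exact ⟨fun q => abs_le.2 (f q.out).2, Quotient.mk _ i,
        (congrArg (fun x : D1 => |(x : ℝ)|) (out_eq f hf i)).trans hi⟩⟩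
    invFun h := ⟨fun i => ⟨h.1 (Quotient.mk _ i),
        abs_le.1 (((pi_norm_eq_one_iff h.1).1 (mem_sphere_zero_iff_norm.1 h.2)).1 _)⟩, by
      obtain ⟨h, hh⟩ := h
      obtain ⟨-, q, hq⟩ := (pi_norm_eq_one_iff h).1 (mem_sphere_zero_iff_norm.1 hh)
      refine ⟨(filter_notMem_S0_mem_simplexBoundary_iff _).2 ⟨q.out, by simpa using hq⟩, ?_⟩
      intro g hg i
      ext1
      exact congrArg h (Quotient.sound ⟨⟨g⁻¹, inv_mem hg⟩, rfl⟩)⟩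
    left_inv f := by
      ext i
      exact congrArg Subtype.val (out_eq f.1 f.2.2 i)
    right_inv h := by
      ext q
      simp
    continuous_toFun := Continuous.subtype_mk (continuous_pi fun q =>
      continuous_subtype_val.comp ((continuous_apply _).comp continuous_subtype_val)) _
    continuous_invFun := Continuous.subtype_mk (continuous_pi fun i =>
      Continuous.subtype_mk ((continuous_apply _).comp continuous_subtype_val) _) _ }

theorem card_orbits_eq_card_iff_eq_bot {α : Type*} [Finite α] (G : Subgroup (Equiv.Perm α)) :
    Nat.card (Quotient (MulAction.orbitRel G α)) = Nat.card α ↔ G = ⊥ := by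
  have hsurj : Function.Surjective (Quotient.mk (MulAction.orbitRel G α)) := Quotient.mk_surjective
  constructor
  · intro hcard
    have hinj := (hsurj.bijective_of_nat_card_le hcard.ge).injective
    refine (Subgroup.eq_bot_iff_forall G).2 fun g hg => Equiv.ext fun i => ?_
    exact hinj (Quotient.sound ⟨⟨g, hg⟩, rfl⟩)
  · rintro rfl
    refine (Nat.card_eq_of_bijective _ ⟨fun i j hij => ?_, hsurj⟩).symm
    obtain ⟨g, hg⟩ := Quotient.exact hij
    rw [← hg, Subsingleton.elim g 1]
    exact one_smul _ j

/-- For any subgroup `G` of `Perm (Fin (n+1))` acting on the `n`-sphere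
`Z(∂Δ^n;(D¹,S⁰))`, the fixed point set is homeomorphic to the `(r-1)`-sphere, where `r` is
the number of `G`-orbits on `Fin (n+1)`; moreover `r = n+1` iff `G` is trivial, so the fixed
point set is homeomorphic to the `n`-sphere iff `G` is trivial. -/
theorem sphere_fixedPoints_homeomorph (n : ℕ) (G : Subgroup (Equiv.Perm (Fin (n + 1)))) :
    Nonempty (
      {f : Fin (n + 1) → D1 //
          Finset.filter (fun i => f i ∉ S0) Finset.univ ∈ simplexBoundary n ∧
          ∀ g ∈ G, ∀ i : Fin (n + 1), f (g⁻¹ i) = f i} ≃ₜ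
      Metric.sphere
        (0 : EuclideanSpace ℝ
          (Fin (Nat.card (Quotient (MulAction.orbitRel G (Fin (n + 1))))))) 1) ∧
    (Nat.card (Quotient (MulAction.orbitRel G (Fin (n + 1)))) = n + 1 ↔ G = ⊥) := by
  refine ⟨⟨(fixedPointsHomeomorphSupSphere n G).trans
    (ContinuousLinearEquiv.unitSphereHomeomorph ?_)⟩, ?_⟩
  · exact (LinearEquiv.funCongrLeft ℝ ℝ (Finite.equivFin _).symm).toContinuousLinearEquiv.trans
      (EuclideanSpace.equiv _ ℝ).symm
  · simpa using card_orbits_eq_card_iff_eq_bot G
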